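/- Fix p ∈ (0,1), α with 0 < α < 1/(1+p), and a grading exponent q > 4/α. For each n ≥ 1 let π_h be the piecewise-constant mean-value projection on the graded mesh with nodes t_i = (i/n)^q. Then there is a constant C, independent of n and u, such that for every u ∈ C⁴_α and every x ∈ (0,1], (K(I − π_h)u)(x) = (1/12)·∑_{i=2}^{n} h_i² ∫_{τ_i} ∂_y k(x,y)·u′(y) dy + R_n(x), where sup_{x ∈ (0,1]} |R_n(x)| ≤ C·n^{−4}·‖u‖_{4,α}. -/

import Mathlib

open MeasureTheory Real

/-- The double-layer corner kernel
`k(x,y) = (sin(pπ)/π)·x/(x² + y² + 2xy·cos(pπ))` for a corner of interior angle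
`(1−p)π`. -/
noncomputable def cornerKernel (p x y : ℝ) : ℝ :=
  Real.sin (p * Real.pi) / Real.pi * x / (x ^ 2 + y ^ 2 + 2 * x * y * Real.cos (p * Real.pi))

/-- The corner operator `(Ku)(x) = ∫₀¹ k(x,y)·u(y) dy`. -/
noncomputable def cornerOp (p : ℝ) (u : ℝ → ℝ) (x : ℝ) : ℝ :=
  ∫ y in Set.Ioc (0 : ℝ) 1, cornerKernel p x y * u y

/-- Node `t_i = (i/n)^q` of the graded mesh on `[0,1]` with grading exponent `q`. -/
noncomputable def gradedNode (n : ℕ) (q : ℝ) (i : ℕ) : ℝ :=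
  ((i : ℝ) / (n : ℝ)) ^ q

/-- The piecewise-constant mean-value (Galerkin) projection `π_h` on the graded mesh:
on each subinterval `τ_i = (t_{i−1}, t_i]` the function is replaced by its mean value. -/
noncomputable def gradedProj (n : ℕ) (q : ℝ) (u : ℝ → ℝ) (x : ℝ) : ℝ :=
  ∑ i ∈ Finset.Icc 1 n,
    Set.indicator (Set.Ioc (gradedNode n q (i - 1)) (gradedNode n q i))
      (fun _ => (gradedNode n q i - gradedNode n q (i - 1))⁻¹ *
        ∫ y in Set.Ioc (gradedNode n q (i - 1)) (gradedNode n q i), u y) x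

/-- The set of weighted values whose supremum is the weighted norm
`‖u‖_{m,α} = max_{0≤i≤m} sup_{t∈(0,1]} t^{max(i−α,0)}·|u^{(i)}(t)|`, with derivatives
taken within `(0,1]`. -/
def weightedSet (m : ℕ) (α : ℝ) (u : ℝ → ℝ) : Set ℝ :=
  {r : ℝ | ∃ i ≤ m, ∃ t ∈ Set.Ioc (0 : ℝ) 1,
    r = t ^ max ((i : ℝ) - α) 0 * |iteratedDerivWithin i u (Set.Ioc 0 1) t|}

/-- The weighted norm `‖u‖_{m,α}`. -/
noncomputable def weightedNorm (m : ℕ) (α : ℝ) (u : ℝ → ℝ) : ℝ :=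
  sSup (weightedSet m α u)

/-- `K(I − π_h)u`, the corner operator applied to the projection error of `u`. -/
noncomputable def cornerErr (p q : ℝ) (n : ℕ) (u : ℝ → ℝ) : ℝ → ℝ :=
  fun x => cornerOp p (fun y => u y - gradedProj n q u y) x


noncomputable def bForm (a b : ℝ) (f f' g g' : ℝ → ℝ) : ℝ :=
  (∫ y in a..b, f y * g y) - (b - a)⁻¹ * (∫ y in a..b, f y) * (∫ y in a..b, g y)
    - (b - a) ^ 2 / 12 * ∫ y in a..b, f' y * g' y

lemma bForm_comm (a b : ℝ) (f f' g g' : ℝ → ℝ) :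
    bForm a b f f' g g' = bForm a b g g' f f' := by
  unfold bForm
  simp only [mul_comm (f _), mul_comm (f' _)]
  ring

lemma bForm_congr {a b : ℝ} (hab : a ≤ b) {f f' g g' F F' : ℝ → ℝ}
    (h : ∀ y ∈ Set.Icc a b, f y = F y) (h' : ∀ y ∈ Set.Icc a b, f' y = F' y) :
    bForm a b f f' g g' = bForm a b F F' g g' := by
  unfold bForm
  have e1 : ∫ y in a..b, f y * g y = ∫ y in a..b, F y * g y :=
    intervalIntegral.integral_congr fun y hy => by
      rw [Set.uIcc_of_le hab] at hy; simp only [h y hy]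
  have e2 : ∫ y in a..b, f y = ∫ y in a..b, F y :=
    intervalIntegral.integral_congr fun y hy => by
      rw [Set.uIcc_of_le hab] at hy; simp only [h y hy]
  have e3 : ∫ y in a..b, f' y * g' y = ∫ y in a..b, F' y * g' y :=
    intervalIntegral.integral_congr fun y hy => by
      rw [Set.uIcc_of_le hab] at hy; simp only [h' y hy]
  rw [e1, e2, e3]

lemma bForm_add {a b : ℝ} (hab : a ≤ b) {f f' e e' g g' : ℝ → ℝ}
    (hf : ContinuousOn f (Set.Icc a b)) (hf' : ContinuousOn f' (Set.Icc a b))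
    (he : ContinuousOn e (Set.Icc a b)) (he' : ContinuousOn e' (Set.Icc a b))
    (hg : ContinuousOn g (Set.Icc a b)) (hg' : ContinuousOn g' (Set.Icc a b)) :
    bForm a b (fun y => f y + e y) (fun y => f' y + e' y) g g' =
      bForm a b f f' g g' + bForm a b e e' g g' := by
  unfold bForm
  simp only [add_mul]
  rw [← Set.uIcc_of_le hab] at *
  have e1 : ∫ y in a..b, (f y * g y + e y * g y) =
      (∫ y in a..b, f y * g y) + ∫ y in a..b, e y * g y :=
    intervalIntegral.integral_add (hf.mul hg).intervalIntegrable (he.mul hg).intervalIntegrable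
  have e2 : ∫ y in a..b, (f y + e y) = (∫ y in a..b, f y) + ∫ y in a..b, e y :=
    intervalIntegral.integral_add hf.intervalIntegrable he.intervalIntegrable
  have e3 : ∫ y in a..b, (f' y * g' y + e' y * g' y) =
      (∫ y in a..b, f' y * g' y) + ∫ y in a..b, e' y * g' y :=
    intervalIntegral.integral_add (hf'.mul hg').intervalIntegrable
      (he'.mul hg').intervalIntegrable
  rw [e1, e2, e3]
  ring

lemma bForm_const {a b : ℝ} (hab : a < b) (c : ℝ) (g g' : ℝ → ℝ) :
    bForm a b (fun _ => c) (fun _ => 0) g g' = 0 := by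
  unfold bForm
  have : b - a ≠ 0 := by linarith
  simp
  field_simp
  ring

lemma bForm_bound {a b : ℝ} (hab : a < b) {f f' g g' : ℝ → ℝ} {P G : ℝ}
    (hf : ∀ y ∈ Set.Icc a b, |f y| ≤ P) (hf' : ∀ y ∈ Set.Icc a b, (b - a) * |f' y| ≤ P)
    (hg : ∀ y ∈ Set.Icc a b, |g y| ≤ G) (hg' : ∀ y ∈ Set.Icc a b, (b - a) * |g' y| ≤ G) :
    |bForm a b f f' g g'| ≤ 3 * (b - a) * P * G := by
  have hh : 0 < b - a := by linarith
  have hP : 0 ≤ P := (abs_nonneg _).trans (hf a ⟨le_rfl, hab.le⟩)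
  have hG : 0 ≤ G := (abs_nonneg _).trans (hg a ⟨le_rfl, hab.le⟩)
  have sub : ∀ y, y ∈ Set.uIoc a b → y ∈ Set.Icc a b := fun y hy => by
    rw [Set.uIoc_of_le hab.le] at hy; exact ⟨hy.1.le, hy.2⟩
  have e : |b - a| = b - a := abs_of_pos hh
  have key : ∀ (φ : ℝ → ℝ) (C : ℝ), (∀ y ∈ Set.Icc a b, |φ y| ≤ C) →
      |∫ y in a..b, φ y| ≤ C * (b - a) := by
    intro φ C hφ
    have := intervalIntegral.norm_integral_le_of_norm_le_const (a := a) (b := b) (f := φ) (C := C)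
      (fun y hy => hφ y (sub y hy))
    rwa [Real.norm_eq_abs, e] at this
  have h1 : |∫ y in a..b, f y * g y| ≤ P * G * (b - a) := by
    refine key _ _ fun y hy => ?_
    rw [abs_mul]
    exact mul_le_mul (hf y hy) (hg y hy) (abs_nonneg _) hP
  have h2 : |∫ y in a..b, f y| ≤ P * (b - a) := key _ _ hf
  have h3 : |∫ y in a..b, g y| ≤ G * (b - a) := key _ _ hg
  have h4 : |∫ y in a..b, f' y * g' y| ≤ (P / (b - a)) * (G / (b - a)) * (b - a) := by
    refine key _ _ fun y hy => ?_
    rw [abs_mul]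
    refine mul_le_mul ?_ ?_ (abs_nonneg _) (by positivity)
    · rw [le_div_iff₀ hh, mul_comm]; exact hf' y hy
    · rw [le_div_iff₀ hh, mul_comm]; exact hg' y hy
  have h5 : |(b - a)⁻¹ * (∫ y in a..b, f y) * (∫ y in a..b, g y)| ≤ P * G * (b - a) := by
    rw [abs_mul, abs_mul, abs_of_pos (inv_pos.2 hh)]
    calc _ ≤ (b - a)⁻¹ * (P * (b - a)) * (G * (b - a)) := by gcongr
      _ = _ := by field_simp
  have h6 : |(b - a) ^ 2 / 12 * ∫ y in a..b, f' y * g' y| ≤ P * G * (b - a) := by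
    rw [abs_mul, abs_of_pos (by positivity)]
    calc _ ≤ (b - a) ^ 2 / 12 * ((P / (b - a)) * (G / (b - a)) * (b - a)) := by gcongr
      _ = P * G * (b - a) / 12 := by field_simp
      _ ≤ _ := by have : 0 ≤ P * G * (b - a) := by positivity
                  linarith
  unfold bForm
  rw [abs_le] at *
  constructor <;> linarith [h1.1, h1.2, h5.1, h5.2, h6.1, h6.2]

lemma bForm_quad {a b : ℝ} (hab : a < b) (p1 p2 r1 r2 : ℝ) :
    bForm a b (fun y => p1 * (y - a) + p2 / 2 * (y - a) ^ 2) (fun y => p1 + p2 * (y - a))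
      (fun y => r1 * (y - a) + r2 / 2 * (y - a) ^ 2) (fun y => r1 + r2 * (y - a))
      = - (b - a) ^ 5 / 180 * p2 * r2 := by
  have hh : b - a ≠ 0 := by linarith
  unfold bForm
  have A : ∫ y in a..b, (p1 * (y - a) + p2 / 2 * (y - a) ^ 2) *
      (r1 * (y - a) + r2 / 2 * (y - a) ^ 2) = p1 * r1 * (b - a) ^ 3 / 3 +
      (p1 * r2 + p2 * r1) / 2 * (b - a) ^ 4 / 4 + p2 * r2 / 4 * (b - a) ^ 5 / 5 := by
    rw [intervalIntegral.integral_eq_sub_of_hasDerivAt (f := fun y => p1 * r1 * (y - a) ^ 3 / 3 +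
      (p1 * r2 + p2 * r1) / 2 * (y - a) ^ 4 / 4 + p2 * r2 / 4 * (y - a) ^ 5 / 5)]
    · simp
    · intro y _
      have d := (hasDerivAt_id y).sub_const a
      refine HasDerivAt.congr_deriv ((((d.pow 3).const_mul (p1 * r1)).div_const 3).add
        (((d.pow 4).const_mul ((p1 * r2 + p2 * r1) / 2)).div_const 4) |>.add
        (((d.pow 5).const_mul (p2 * r2 / 4)).div_const 5)) ?_
      simp; ring
    · apply Continuous.intervalIntegrable; fun_prop
  have Bq : ∀ s1 s2 : ℝ, ∫ y in a..b, (s1 * (y - a) + s2 / 2 * (y - a) ^ 2) =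
      s1 * (b - a) ^ 2 / 2 + s2 * (b - a) ^ 3 / 6 := by
    intro s1 s2
    rw [intervalIntegral.integral_eq_sub_of_hasDerivAt (f := fun y => s1 * (y - a) ^ 2 / 2 +
      s2 * (y - a) ^ 3 / 6)]
    · simp
    · intro y _
      have d := (hasDerivAt_id y).sub_const a
      refine HasDerivAt.congr_deriv ((((d.pow 2).const_mul s1).div_const 2).add
        (((d.pow 3).const_mul s2).div_const 6)) ?_
      simp; ring
    · apply Continuous.intervalIntegrable; fun_prop
  have D : ∫ y in a..b, (p1 + p2 * (y - a)) * (r1 + r2 * (y - a)) = p1 * r1 * (b - a) +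
      (p1 * r2 + p2 * r1) * (b - a) ^ 2 / 2 + p2 * r2 * (b - a) ^ 3 / 3 := by
    rw [intervalIntegral.integral_eq_sub_of_hasDerivAt (f := fun y => p1 * r1 * (y - a) +
      (p1 * r2 + p2 * r1) * (y - a) ^ 2 / 2 + p2 * r2 * (y - a) ^ 3 / 3)]
    · simp
    · intro y _
      have d := (hasDerivAt_id y).sub_const a
      refine HasDerivAt.congr_deriv (((d.const_mul (p1 * r1))).add
        (((d.pow 2).const_mul ((p1 * r2 + p2 * r1))).div_const 2) |>.add
        (((d.pow 3).const_mul (p2 * r2)).div_const 3)) ?_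
      simp; ring
    · apply Continuous.intervalIntegrable; fun_prop
  rw [A, Bq, Bq, D]
  field_simp
  ring

lemma taylor3 {a b : ℝ} (hab : a ≤ b) {f0 f1 f2 f3 : ℝ → ℝ} {D : ℝ}
    (h0 : ∀ y ∈ Set.Icc a b, HasDerivWithinAt f0 (f1 y) (Set.Icc a b) y)
    (h1 : ∀ y ∈ Set.Icc a b, HasDerivWithinAt f1 (f2 y) (Set.Icc a b) y)
    (h2 : ∀ y ∈ Set.Icc a b, HasDerivWithinAt f2 (f3 y) (Set.Icc a b) y)
    (h3 : ∀ y ∈ Set.Icc a b, |f3 y| ≤ D) :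
    ∀ y ∈ Set.Icc a b, |f1 y - f1 a - f2 a * (y - a)| ≤ D * (b - a) ^ 2 ∧
      |f0 y - f0 a - f1 a * (y - a) - f2 a / 2 * (y - a) ^ 2| ≤ D * (b - a) ^ 3 := by
  have hD : 0 ≤ D := (abs_nonneg _).trans (h3 a ⟨le_rfl, hab⟩)
  have s2 : ∀ y ∈ Set.Icc a b, |f2 y - f2 a| ≤ D * (b - a) := fun y hy =>
    (norm_image_sub_le_of_norm_deriv_le_segment' h2
      (fun z hz => h3 z ⟨hz.1, hz.2.le⟩) y hy).trans (by
        have := hy.2; gcongr)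
  have s1 : ∀ y ∈ Set.Icc a b, |f1 y - f1 a - f2 a * (y - a)| ≤ D * (b - a) ^ 2 := by
    intro y hy
    have := norm_image_sub_le_of_norm_deriv_le_segment' (a := a) (b := b)
      (f := fun y => f1 y - f2 a * (y - a)) (f' := fun y => f2 y - f2 a * 1)
      (fun z hz => (h1 z hz).sub (((hasDerivWithinAt_id z _).sub_const a).const_mul (f2 a)))
      (C := D * (b - a))
      (fun z hz => by simpa using s2 z ⟨hz.1, hz.2.le⟩) y hy
    have e : f1 y - f2 a * (y - a) - (f1 a - f2 a * (a - a)) = f1 y - f1 a - f2 a * (y - a) := by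
      ring
    rw [e] at this
    refine this.trans ?_
    have h4 : 0 ≤ b - a := by linarith
    calc D * (b - a) * (y - a) ≤ D * (b - a) * (b - a) := by
          have := hy.2; gcongr
      _ = _ := by ring
  intro y hy
  refine ⟨s1 y hy, ?_⟩
  have := norm_image_sub_le_of_norm_deriv_le_segment' (a := a) (b := b)
      (f := fun y => f0 y - f1 a * (y - a) - f2 a / 2 * (y - a) ^ 2)
      (f' := fun y => f1 y - f1 a - f2 a * (y - a))
      (fun z hz => by
        have d := (hasDerivWithinAt_id z (Set.Icc a b)).sub_const a
        refine HasDerivWithinAt.congr_deriv (((h0 z hz).sub (d.const_mul (f1 a))).sub ((d.pow 2).const_mul (f2 a / 2))) ?_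
        simp; ring)
      (C := D * (b - a) ^ 2)
      (fun z hz => s1 z ⟨hz.1, hz.2.le⟩) y hy
  have e : f0 y - f1 a * (y - a) - f2 a / 2 * (y - a) ^ 2 -
    (f0 a - f1 a * (a - a) - f2 a / 2 * (a - a) ^ 2) =
    f0 y - f0 a - f1 a * (y - a) - f2 a / 2 * (y - a) ^ 2 := by
    ring
  rw [e] at this
  refine this.trans ?_
  calc D * (b - a) ^ 2 * (y - a) ≤ D * (b - a) ^ 2 * (b - a) := by
        have := hy.2; gcongr
    _ = _ := by ring

/-- decomposition data of one factor -/
lemma decomp {a b : ℝ} (hab : a < b) {f0 f1 f2 f3 : ℝ → ℝ} {F ε : ℝ} (hε : 0 ≤ ε)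
    (h0 : ∀ y ∈ Set.Icc a b, HasDerivWithinAt f0 (f1 y) (Set.Icc a b) y)
    (h1 : ∀ y ∈ Set.Icc a b, HasDerivWithinAt f1 (f2 y) (Set.Icc a b) y)
    (h2 : ∀ y ∈ Set.Icc a b, HasDerivWithinAt f2 (f3 y) (Set.Icc a b) y)
    (b1 : ∀ y ∈ Set.Icc a b, |f1 y| * (b - a) ≤ F * ε)
    (b2 : ∀ y ∈ Set.Icc a b, |f2 y| * (b - a) ^ 2 ≤ F * ε ^ 2)
    (b3 : ∀ y ∈ Set.Icc a b, |f3 y| * (b - a) ^ 3 ≤ F * ε ^ 3) :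
    ∃ (c p1 p2 : ℝ) (r r' : ℝ → ℝ), ContinuousOn r (Set.Icc a b) ∧ ContinuousOn r' (Set.Icc a b) ∧
      (∀ y, f0 y = c + ((p1 * (y - a) + p2 / 2 * (y - a) ^ 2) + r y)) ∧
      (∀ y, f1 y = 0 + ((p1 + p2 * (y - a)) + r' y)) ∧
      (∀ y ∈ Set.Icc a b, |r y| ≤ F * ε ^ 3) ∧
      (∀ y ∈ Set.Icc a b, (b - a) * |r' y| ≤ F * ε ^ 3) ∧
      |p2| * (b - a) ^ 2 ≤ F * ε ^ 2 ∧
      (∀ y ∈ Set.Icc a b, |p1 * (y - a) + p2 / 2 * (y - a) ^ 2| ≤ F * (ε + ε ^ 2)) ∧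
      (∀ y ∈ Set.Icc a b, (b - a) * |p1 + p2 * (y - a)| ≤ F * (ε + ε ^ 2)) := by
  have hh : 0 < b - a := by linarith
  have ha : a ∈ Set.Icc a b := ⟨le_rfl, hab.le⟩
  have c0 : ContinuousOn f0 (Set.Icc a b) := fun y hy => (h0 y hy).continuousWithinAt
  have c1 : ContinuousOn f1 (Set.Icc a b) := fun y hy => (h1 y hy).continuousWithinAt
  have T := taylor3 hab.le h0 h1 h2 (D := F * ε ^ 3 / (b - a) ^ 3)
    (fun y hy => by rw [le_div_iff₀ (by positivity)]; exact b3 y hy)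
  have B1 := b1 a ha
  have B2 := b2 a ha
  refine ⟨f0 a, f1 a, f2 a, fun y => f0 y - f0 a - f1 a * (y - a) - f2 a / 2 * (y - a) ^ 2,
    fun y => f1 y - f1 a - f2 a * (y - a), by fun_prop, by fun_prop, fun y => by ring,
    fun y => by ring, fun y hy => ?_, fun y hy => ?_, B2, fun y hy => ?_, fun y hy => ?_⟩
  · refine (T y hy).2.trans (le_of_eq ?_); field_simp
  · calc _ ≤ (b - a) * (F * ε ^ 3 / (b - a) ^ 3 * (b - a) ^ 2) := by gcongr; exact (T y hy).1
      _ = _ := by field_simp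
  · have y0 : 0 ≤ y - a := by linarith [hy.1]
    have y1 : y - a ≤ b - a := by linarith [hy.2]
    calc _ ≤ |f1 a * (y - a)| + |f2 a / 2 * (y - a) ^ 2| := abs_add_le _ _
      _ = |f1 a| * (y - a) + |f2 a| / 2 * (y - a) ^ 2 := by
          rw [abs_mul, abs_mul, abs_div, abs_of_nonneg y0, abs_of_nonneg (pow_nonneg y0 2)]; norm_num
      _ ≤ |f1 a| * (b - a) + |f2 a| / 1 * (b - a) ^ 2 := by gcongr; norm_num
      _ ≤ _ := by linarith
  · have y0 : 0 ≤ y - a := by linarith [hy.1]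
    have y1 : y - a ≤ b - a := by linarith [hy.2]
    calc _ ≤ (b - a) * (|f1 a| + |f2 a * (y - a)|) := by gcongr; exact abs_add_le _ _
      _ = (b - a) * (|f1 a| + |f2 a| * (y - a)) := by
          rw [abs_mul, abs_of_nonneg y0]
      _ ≤ (b - a) * (|f1 a| + |f2 a| * (b - a)) := by gcongr
      _ ≤ _ := by linarith

lemma local_bound {a b : ℝ} (hab : a < b) {f0 f1 f2 f3 g0 g1 g2 g3 : ℝ → ℝ} {F G ε M : ℝ}
    (hε : 0 ≤ ε) (hM : ε ≤ M) (hF : 0 ≤ F) (hG : 0 ≤ G)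
    (h0 : ∀ y ∈ Set.Icc a b, HasDerivWithinAt f0 (f1 y) (Set.Icc a b) y)
    (h1 : ∀ y ∈ Set.Icc a b, HasDerivWithinAt f1 (f2 y) (Set.Icc a b) y)
    (h2 : ∀ y ∈ Set.Icc a b, HasDerivWithinAt f2 (f3 y) (Set.Icc a b) y)
    (b1 : ∀ y ∈ Set.Icc a b, |f1 y| * (b - a) ≤ F * ε)
    (b2 : ∀ y ∈ Set.Icc a b, |f2 y| * (b - a) ^ 2 ≤ F * ε ^ 2)
    (b3 : ∀ y ∈ Set.Icc a b, |f3 y| * (b - a) ^ 3 ≤ F * ε ^ 3)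
    (h0' : ∀ y ∈ Set.Icc a b, HasDerivWithinAt g0 (g1 y) (Set.Icc a b) y)
    (h1' : ∀ y ∈ Set.Icc a b, HasDerivWithinAt g1 (g2 y) (Set.Icc a b) y)
    (h2' : ∀ y ∈ Set.Icc a b, HasDerivWithinAt g2 (g3 y) (Set.Icc a b) y)
    (b1' : ∀ y ∈ Set.Icc a b, |g1 y| * (b - a) ≤ G * ε)
    (b2' : ∀ y ∈ Set.Icc a b, |g2 y| * (b - a) ^ 2 ≤ G * ε ^ 2)
    (b3' : ∀ y ∈ Set.Icc a b, |g3 y| * (b - a) ^ 3 ≤ G * ε ^ 3) :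
    |bForm a b f0 f1 g0 g1| ≤ (1 + 6 * (1 + M) + 3 * M ^ 2) * ((b - a) * F * G * ε ^ 4) := by
  have hh : 0 < b - a := by linarith
  obtain ⟨c, p1, p2, r, r', cr, cr', e0, e1, hr, hr', hp2, hP, hP'⟩ :=
    decomp hab hε h0 h1 h2 b1 b2 b3
  obtain ⟨d, s1, s2, v, v', cv, cv', i0, i1, hv, hv', hs2, hQ, hQ'⟩ :=
    decomp hab hε h0' h1' h2' b1' b2' b3'
  have cg0 : ContinuousOn g0 (Set.Icc a b) := fun y hy => (h0' y hy).continuousWithinAt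
  have cg1 : ContinuousOn g1 (Set.Icc a b) := fun y hy => (h1' y hy).continuousWithinAt
  have step : ∀ (φ φ' : ℝ → ℝ), ContinuousOn φ (Set.Icc a b) → ContinuousOn φ' (Set.Icc a b) →
      bForm a b φ φ' g0 g1 = bForm a b φ φ' (fun y => s1 * (y - a) + s2 / 2 * (y - a) ^ 2)
        (fun y => s1 + s2 * (y - a)) + bForm a b φ φ' v v' := by
    intro φ φ' cφ cφ'
    rw [bForm_comm, bForm_congr hab.le (fun y _ => i0 y) (fun y _ => i1 y),
      bForm_add hab.le (by fun_prop) (by fun_prop) (by fun_prop) (by fun_prop) cφ cφ',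
      bForm_const hab, bForm_add hab.le (by fun_prop) (by fun_prop) cv cv' cφ cφ', zero_add,
      bForm_comm, bForm_comm a b v]
  rw [bForm_congr hab.le (fun y _ => e0 y) (fun y _ => e1 y),
      bForm_add hab.le (by fun_prop) (by fun_prop) (by fun_prop) (by fun_prop) cg0 cg1,
      bForm_const hab, bForm_add hab.le (by fun_prop) (by fun_prop) cr cr' cg0 cg1, zero_add,
      step _ _ (by fun_prop) (by fun_prop), step _ _ cr cr', bForm_quad hab]
  have t1 : |(-(b - a) ^ 5 / 180 * p2 * s2)| ≤ (b - a) * F * G * ε ^ 4 := by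
    rw [abs_mul, abs_mul, abs_div, abs_neg, abs_of_pos (pow_pos hh 5)]
    calc _ = (b - a) / 180 * ((|p2| * (b - a) ^ 2) * (|s2| * (b - a) ^ 2)) := by
            norm_num; ring
      _ ≤ (b - a) / 1 * ((F * ε ^ 2) * (G * ε ^ 2)) := by
            gcongr; norm_num
      _ = _ := by ring
  have t2 := bForm_bound hab hP hP' hv hv'
  have t3 := bForm_bound hab hr hr' hQ hQ'
  have t4 := bForm_bound hab hr hr' hv hv'
  set X := (b - a) * F * G * ε ^ 4 with hX
  have hX0 : 0 ≤ X := by positivity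
  have u2 : 3 * (b - a) * (F * (ε + ε ^ 2)) * (G * ε ^ 3) ≤ 3 * (1 + M) * X := by
    calc _ = 3 * (1 + ε) * X := by rw [hX]; ring
      _ ≤ _ := by gcongr
  have u3 : 3 * (b - a) * (F * ε ^ 3) * (G * (ε + ε ^ 2)) ≤ 3 * (1 + M) * X := by
    calc _ = 3 * (1 + ε) * X := by rw [hX]; ring
      _ ≤ _ := by gcongr
  have u4 : 3 * (b - a) * (F * ε ^ 3) * (G * ε ^ 3) ≤ 3 * M ^ 2 * X := by
    calc _ = 3 * ε ^ 2 * X := by rw [hX]; ring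
      _ ≤ _ := by gcongr
  refine (abs_add_le _ _).trans ((add_le_add (abs_add_le _ _) (abs_add_le _ _)).trans ?_)
  linarith

lemma kernel_data (p : ℝ) (hp0 : 0 < p) (hp1 : p < 1) :
    ∃ K : ℝ, 0 < K ∧ ∀ x : ℝ, 0 < x → ∃ k1 k2 k3 : ℝ → ℝ, ∀ y : ℝ, 0 ≤ y →
      HasDerivAt (fun z => cornerKernel p x z) (k1 y) y ∧ HasDerivAt k1 (k2 y) y ∧
      HasDerivAt k2 (k3 y) y ∧
      |cornerKernel p x y| ≤ K * (x / (x + y) ^ 2) ∧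
      |k1 y| * (x + y) ≤ K * (x / (x + y) ^ 2) ∧
      |k2 y| * (x + y) ^ 2 ≤ K * (x / (x + y) ^ 2) ∧
      |k3 y| * (x + y) ^ 3 ≤ K * (x / (x + y) ^ 2) := by
  set c := Real.cos (p * Real.pi) with hc
  have hpi := Real.pi_pos
  have c1 : c < 1 := by
    have := Real.cos_lt_cos_of_nonneg_of_le_pi (x := 0) (y := p * π) le_rfl
      (by nlinarith) (by positivity)
    simpa using this
  have c2 : -1 < c := by
    have := Real.cos_lt_cos_of_nonneg_of_le_pi (x := p * π) (y := π) (by positivity)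
      le_rfl (by nlinarith)
    simpa using this
  set δ := (1 + c) / 2 with hδ
  have δ0 : 0 < δ := by rw [hδ]; linarith
  have δ1 : δ ≤ 1 := by rw [hδ]; linarith
  refine ⟨1 / δ + 2 / δ ^ 2 + (2 / δ ^ 2 + 8 / δ ^ 3) + (24 / δ ^ 3 + 48 / δ ^ 4),
    by positivity, ?_⟩
  intro x hx
  obtain ⟨A, hA⟩ : ∃ A, A = Real.sin (p * Real.pi) / Real.pi * x := ⟨_, rfl⟩
  have hA1 : |A| ≤ x := by
    rw [hA, abs_mul, abs_div, abs_of_pos hpi, abs_of_pos hx]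
    have : |Real.sin (p * π)| / π ≤ 1 := by
      rw [div_le_one hpi]; linarith [Real.abs_sin_le_one (p * π), Real.pi_gt_three]
    nlinarith
  obtain ⟨D, hD⟩ : ∃ D : ℝ → ℝ, D = fun y => x ^ 2 + y ^ 2 + 2 * x * y * c := ⟨_, rfl⟩
  obtain ⟨E, hE⟩ : ∃ E : ℝ → ℝ, E = fun y => 2 * (y + x * c) := ⟨_, rfl⟩
  refine ⟨fun y => - A * E y / D y ^ 2, fun y => - 2 * A / D y ^ 2 + 2 * A * E y ^ 2 / D y ^ 3,
    fun y => 12 * A * E y / D y ^ 3 - 6 * A * E y ^ 3 / D y ^ 4, ?_⟩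
  intro y hy
  have hS : 0 < x + y := by linarith
  have hDS : δ * (x + y) ^ 2 ≤ D y := by
    simp only [hD, hδ]; nlinarith [mul_nonneg (sub_nonneg.2 c1.le) (sq_nonneg (x - y))]
  have hD0 : 0 < D y := lt_of_lt_of_le (by positivity) hDS
  have hES : |E y| ≤ 2 * (x + y) := by
    simp only [hE]; rw [abs_le]; constructor <;> nlinarith
  have dD : HasDerivAt D (E y) y := by
    rw [hD]
    refine HasDerivAt.congr_deriv ((((hasDerivAt_id y).pow 2).const_add (x ^ 2)).add
      (((hasDerivAt_id y).const_mul (2 * x)).mul_const c)) ?_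
    simp [hE]; ring
  have dE : HasDerivAt E 2 y := by
    rw [hE]
    refine HasDerivAt.congr_deriv (((hasDerivAt_id y).add_const (x * c)).const_mul 2) ?_
    simp
  have hker : ∀ z, cornerKernel p x z = A / D z := fun z => by
    simp only [cornerKernel, hA, hD, hc]
  have hne := hD0.ne'
  refine ⟨?_, ?_, ?_, ?_, ?_, ?_, ?_⟩
  · simp only [hker]
    refine HasDerivAt.congr_deriv ((hasDerivAt_const y A).div dD hne) ?_
    simp
  · refine HasDerivAt.congr_deriv ((dE.const_mul (-A)).div (dD.pow 2) (pow_ne_zero 2 hne)) ?_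
    simp; field_simp
  · refine HasDerivAt.congr_deriv (((hasDerivAt_const y (-2 * A)).div (dD.pow 2)
      (pow_ne_zero 2 hne)).add (((dE.pow 2).const_mul (2 * A)).div (dD.pow 3) (pow_ne_zero 3 hne))) ?_
    simp; field_simp; ring
  all_goals
    have hw : 0 < x / (x + y) ^ 2 := by positivity
    have q0 : 0 ≤ 1 / δ := by positivity
    have q1 : 0 ≤ 2 / δ ^ 2 := by positivity
    have q2 : 0 ≤ 8 / δ ^ 3 := by positivity
    have q3 : 0 ≤ 24 / δ ^ 3 := by positivity
    have q4 : 0 ≤ 48 / δ ^ 4 := by positivity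
  · rw [hker, abs_div, abs_of_pos hD0]
    calc |A| / D y ≤ x / (δ * (x + y) ^ 2) := by gcongr
      _ = 1 / δ * (x / (x + y) ^ 2) := by field_simp
      _ ≤ _ := by refine mul_le_mul_of_nonneg_right ?_ hw.le; linarith
  · rw [abs_div, abs_mul, abs_neg, abs_of_pos (pow_pos hD0 2)]
    calc |A| * |E y| / D y ^ 2 * (x + y)
        ≤ x * (2 * (x + y)) / (δ * (x + y) ^ 2) ^ 2 * (x + y) := by gcongr
      _ = 2 / δ ^ 2 * (x / (x + y) ^ 2) := by field_simp
      _ ≤ _ := by refine mul_le_mul_of_nonneg_right ?_ hw.le; linarith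
  · calc |-2 * A / D y ^ 2 + 2 * A * E y ^ 2 / D y ^ 3| * (x + y) ^ 2
        ≤ (2 * |A| / D y ^ 2 + 2 * |A| * |E y| ^ 2 / D y ^ 3) * (x + y) ^ 2 := by
          gcongr
          refine (abs_add_le _ _).trans (le_of_eq ?_)
          simp only [abs_div, abs_mul, abs_pow, abs_neg, abs_of_pos hD0]
          norm_num
      _ ≤ (2 * x / (δ * (x + y) ^ 2) ^ 2 + 2 * x * (2 * (x + y)) ^ 2 / (δ * (x + y) ^ 2) ^ 3)
            * (x + y) ^ 2 := by gcongr
      _ = (2 / δ ^ 2 + 8 / δ ^ 3) * (x / (x + y) ^ 2) := by field_simp; ring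
      _ ≤ _ := by refine mul_le_mul_of_nonneg_right ?_ hw.le; linarith
  · calc |12 * A * E y / D y ^ 3 - 6 * A * E y ^ 3 / D y ^ 4| * (x + y) ^ 3
        ≤ (12 * |A| * |E y| / D y ^ 3 + 6 * |A| * |E y| ^ 3 / D y ^ 4) * (x + y) ^ 3 := by
          gcongr
          refine (abs_sub _ _).trans (le_of_eq ?_)
          simp only [abs_div, abs_mul, abs_pow, abs_of_pos hD0]
          norm_num
      _ ≤ (12 * x * (2 * (x + y)) / (δ * (x + y) ^ 2) ^ 3
            + 6 * x * (2 * (x + y)) ^ 3 / (δ * (x + y) ^ 2) ^ 4)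
            * (x + y) ^ 3 := by gcongr
      _ = (24 / δ ^ 3 + 48 / δ ^ 4) * (x / (x + y) ^ 2) := by field_simp; ring
      _ ≤ _ := by refine mul_le_mul_of_nonneg_right ?_ hw.le; linarith

lemma u_bound {α : ℝ} (hα0 : 0 < α) (hα1 : α < 1) {u : ℝ → ℝ}
    (hb : BddAbove (weightedSet 4 α u)) {j : ℕ} (hj : 1 ≤ j) (hj4 : j ≤ 4) {t : ℝ}
    (ht : t ∈ Set.Ioc (0 : ℝ) 1) :
    |iteratedDerivWithin j u (Set.Ioc 0 1) t| * t ^ j ≤ weightedNorm 4 α u * t ^ α := by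
  have h : t ^ max ((j : ℝ) - α) 0 * |iteratedDerivWithin j u (Set.Ioc 0 1) t| ≤
      weightedNorm 4 α u := le_csSup hb ⟨j, hj4, t, ht, rfl⟩
  have hj' : (1 : ℝ) ≤ j := by exact_mod_cast hj
  rw [max_eq_left (by linarith), Real.rpow_sub ht.1, Real.rpow_natCast] at h
  have : 0 < t ^ α := Real.rpow_pos_of_pos ht.1 _
  calc _ = (t ^ j / t ^ α * |iteratedDerivWithin j u (Set.Ioc 0 1) t|) * t ^ α := by field_simp
    _ ≤ _ := by gcongr

lemma u_bound0 {α : ℝ} (hα0 : 0 < α) {u : ℝ → ℝ}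
    (hb : BddAbove (weightedSet 4 α u)) {t : ℝ}
    (ht : t ∈ Set.Ioc (0 : ℝ) 1) : |u t| ≤ weightedNorm 4 α u := by
  have h : t ^ max (((0 : ℕ) : ℝ) - α) 0 * |iteratedDerivWithin 0 u (Set.Ioc 0 1) t| ≤
      weightedNorm 4 α u := le_csSup hb ⟨0, by norm_num, t, ht, rfl⟩
  rw [max_eq_right (by simp; linarith), iteratedDerivWithin_zero] at h
  simpa using h

lemma u_deriv {u : ℝ → ℝ} (hu : ContDiffOn ℝ 4 u (Set.Ioc 0 1)) {j : ℕ} (hj : j < 4) {t : ℝ}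
    (ht : t ∈ Set.Ioc (0 : ℝ) 1) :
    HasDerivWithinAt (iteratedDerivWithin j u (Set.Ioc 0 1))
      (iteratedDerivWithin (j + 1) u (Set.Ioc 0 1) t) (Set.Ioc 0 1) t := by
  rw [iteratedDerivWithin_succ]
  exact (hu.differentiableOn_iteratedDerivWithin (by exact_mod_cast hj)
    (uniqueDiffOn_Ioc 0 1) t ht).hasDerivWithinAt

lemma u_holder {α : ℝ} (hα0 : 0 < α) (hα1 : α < 1) {u : ℝ → ℝ}
    (hu : ContDiffOn ℝ 4 u (Set.Ioc 0 1)) (hb : BddAbove (weightedSet 4 α u)) {z y T : ℝ}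
    (hz : 0 < z) (hy : 0 < y) (hzT : z ≤ T) (hyT : y ≤ T) (hT : T ≤ 1) :
    |u y - u z| ≤ weightedNorm 4 α u / α * T ^ α := by
  wlog hzy : z ≤ y generalizing z y
  · rw [abs_sub_comm]; exact this hy hz hyT hzT (le_of_not_ge hzy)
  set N := weightedNorm 4 α u with hN
  have hN0 : 0 ≤ N := (abs_nonneg _).trans (u_bound0 hα0 hb (t := 1) (by simp))
  have sub : Set.Icc z y ⊆ Set.Ioc 0 1 := fun w hw => ⟨by linarith [hw.1], by linarith [hw.2]⟩
  have d : ∀ w ∈ Set.Icc z y, HasDerivWithinAt u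
      (iteratedDerivWithin 1 u (Set.Ioc 0 1) w) (Set.Ioc 0 1) w := fun w hw => by
    have := u_deriv hu (j := 0) (by norm_num) (sub hw)
    rwa [iteratedDerivWithin_zero] at this
  have := image_norm_le_of_norm_deriv_right_le_deriv_boundary' (a := z) (b := y)
    (f := fun w => u w - u z) (f' := fun w => iteratedDerivWithin 1 u (Set.Ioc 0 1) w)
    (B := fun w => N / α * (w ^ α - z ^ α)) (B' := fun w => N / α * (α * w ^ (α - 1)))
    (fun w hw => (((d w hw).mono sub).sub_const (u z)).continuousWithinAt)
    (fun w hw => by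
      refine ((d w ⟨hw.1, hw.2.le⟩).sub_const (u z)).mono_of_mem_nhdsWithin ?_
      exact Filter.mem_of_superset (Ico_mem_nhdsGE hw.2)
        (fun v hv => ⟨by linarith [hv.1, hw.1], by linarith [hv.2]⟩))
    (by simp)
    (fun w hw => ?_) (fun w hw => ?_) (fun w hw => ?_) (x := y) ⟨hzy, le_rfl⟩
  · rw [Real.norm_eq_abs] at this
    refine this.trans ?_
    have h1 : y ^ α ≤ T ^ α := Real.rpow_le_rpow hy.le hyT hα0.le
    have h2 : 0 ≤ z ^ α := Real.rpow_nonneg hz.le _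
    gcongr; linarith
  · have hw0 : 0 < w := by linarith [hw.1]
    exact (((Real.hasDerivAt_rpow_const (Or.inl hw0.ne')).sub_const _).const_mul
      _).continuousAt.continuousWithinAt
  · have hw0 : 0 < w := by linarith [hw.1]
    exact (((Real.hasDerivAt_rpow_const (Or.inl hw0.ne')).sub_const _).const_mul
      _).hasDerivWithinAt
  · have hw0 : 0 < w := by linarith [hw.1]
    have h1 := u_bound hα0 hα1 hb (j := 1) le_rfl (by norm_num) (sub ⟨hw.1, hw.2.le⟩)
    rw [Real.norm_eq_abs, Real.rpow_sub_one hw0.ne']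
    rw [pow_one, ← le_div_iff₀ hw0] at h1
    refine h1.trans (le_of_eq ?_)
    rw [← hN]
    field_simp

lemma mesh {α q : ℝ} (hα0 : 0 < α) (hα1 : α < 1) (hq : q > 4 / α) {n j : ℕ} (hj : 1 ≤ j)
    (hjn : j + 1 ≤ n) :
    0 < gradedNode n q j ∧ gradedNode n q j < gradedNode n q (j + 1) ∧
    gradedNode n q (j + 1) ≤ 1 ∧
    gradedNode n q (j + 1) ≤ 2 ^ q * gradedNode n q j ∧
    (gradedNode n q (j + 1)) ^ α * ((gradedNode n q (j + 1) - gradedNode n q j) /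
      gradedNode n q j) ^ 4 ≤ 16 * (2 ^ q) ^ 4 * ((n : ℝ) ^ 4)⁻¹ := by
  have hqα : 4 < q * α := by rwa [gt_iff_lt, div_lt_iff₀ hα0] at hq
  have hq4 : 4 < q := by nlinarith [div_pos (by norm_num : (0:ℝ) < 4) hα0]
  have hj' : (1 : ℝ) ≤ j := by exact_mod_cast hj
  have hjn' : (j : ℝ) + 1 ≤ n := by exact_mod_cast hjn
  have hn0 : (0 : ℝ) < n := by linarith
  have hj0 : (0 : ℝ) < j := by linarith
  have hb : gradedNode n q (j + 1) = (((j : ℝ) + 1) / n) ^ q := by simp [gradedNode]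
  have ha : gradedNode n q j = ((j : ℝ) / n) ^ q := rfl
  have a0 : 0 < gradedNode n q j := by rw [ha]; positivity
  have ratio : gradedNode n q (j + 1) = (1 + 1 / (j : ℝ)) ^ q * gradedNode n q j := by
    rw [ha, hb, ← Real.mul_rpow (by positivity) (by positivity)]
    congr 1; field_simp
  have hinv : 1 / (j : ℝ) ≤ 1 := by rw [div_le_one hj0]; exact hj'
  have hinv0 : 0 < 1 / (j : ℝ) := by positivity
  have conv : (1 + 1 / (j : ℝ)) ^ q ≤ 1 + 2 ^ q / j := by
    have hcv := convexOn_rpow (p := q) (by linarith)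
    have := hcv.2 (show (1 : ℝ) ∈ Set.Ici 0 by simp) (show (2 : ℝ) ∈ Set.Ici 0 by simp)
      (show 0 ≤ 1 - 1 / (j : ℝ) by linarith) hinv0.le (by ring)
    simp only [smul_eq_mul, Real.one_rpow] at this
    have e : (1 - 1 / (j : ℝ)) * 1 + 1 / (j : ℝ) * 2 = 1 + 1 / (j : ℝ) := by ring
    rw [e] at this
    calc _ ≤ _ := this
      _ ≤ 1 + 1 / (j : ℝ) * 2 ^ q := by linarith
      _ = _ := by ring
  have h2q : (0 : ℝ) < 2 ^ q := by positivity
  refine ⟨a0, ?_, ?_, ?_, ?_⟩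
  · rw [ha, hb]
    exact Real.rpow_lt_rpow (by positivity) (by gcongr; linarith) (by linarith)
  · rw [hb]
    exact Real.rpow_le_one (by positivity) (by rw [div_le_one hn0]; exact hjn') (by linarith)
  · rw [ratio]
    gcongr; linarith
  · have e1 : (gradedNode n q (j + 1) - gradedNode n q j) / gradedNode n q j =
        (1 + 1 / (j : ℝ)) ^ q - 1 := by
      rw [ratio]; field_simp
    have e0 : 0 ≤ (1 + 1 / (j : ℝ)) ^ q - 1 := by
      have := Real.one_le_rpow (x := 1 + 1 / (j : ℝ)) (z := q) (by linarith) (by linarith)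
      linarith
    have e2 : (gradedNode n q (j + 1)) ^ α ≤ (((j : ℝ) + 1) / n) ^ 4 := by
      rw [hb, ← Real.rpow_mul (by positivity), ← Real.rpow_natCast]
      exact Real.rpow_le_rpow_of_exponent_ge (by positivity)
        (by rw [div_le_one hn0]; exact hjn') (by push_cast; linarith)
    rw [e1]
    calc _ ≤ (((j : ℝ) + 1) / n) ^ 4 * (2 ^ q / j) ^ 4 := by gcongr; linarith
      _ ≤ (((j : ℝ) + j) / n) ^ 4 * (2 ^ q / j) ^ 4 := by gcongr
      _ = _ := by field_simp; ring

lemma term_bound {p α q : ℝ} (hα0 : 0 < α) (hα1 : α < 1) (hq : q > 4 / α) {K : ℝ} (hK : 0 < K)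
    {x : ℝ} (hx : 0 < x) {k1 k2 k3 : ℝ → ℝ}
    (hk : ∀ y : ℝ, 0 ≤ y →
      HasDerivAt (fun z => cornerKernel p x z) (k1 y) y ∧ HasDerivAt k1 (k2 y) y ∧
      HasDerivAt k2 (k3 y) y ∧
      |cornerKernel p x y| ≤ K * (x / (x + y) ^ 2) ∧
      |k1 y| * (x + y) ≤ K * (x / (x + y) ^ 2) ∧
      |k2 y| * (x + y) ^ 2 ≤ K * (x / (x + y) ^ 2) ∧
      |k3 y| * (x + y) ^ 3 ≤ K * (x / (x + y) ^ 2))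
    {u : ℝ → ℝ} (hu : ContDiffOn ℝ 4 u (Set.Ioc 0 1)) (hb : BddAbove (weightedSet 4 α u))
    {n j : ℕ} (hj : 1 ≤ j) (hjn : j + 1 ≤ n) :
    |bForm (gradedNode n q j) (gradedNode n q (j + 1)) (fun z => cornerKernel p x z)
      (deriv (fun z => cornerKernel p x z)) u (derivWithin u (Set.Ioc 0 1))| ≤
      ((1 + 6 * (1 + 2 ^ q) + 3 * (2 ^ q) ^ 2) * (K * 2 ^ q * (16 * (2 ^ q) ^ 4))
        * ((n : ℝ) ^ 4)⁻¹ * weightedNorm 4 α u) *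
        (x / (x + gradedNode n q j) - x / (x + gradedNode n q (j + 1))) := by
  obtain ⟨a0, hab, b1, hba, hm⟩ := mesh hα0 hα1 hq hj hjn
  set a := gradedNode n q j
  set b := gradedNode n q (j + 1)
  set N := weightedNorm 4 α u with hN
  have hN0 : 0 ≤ N := (abs_nonneg _).trans (u_bound0 hα0 hb (t := 1) (by simp))
  have h2q : (0 : ℝ) < 2 ^ q := by positivity
  have h2q1 : (1 : ℝ) ≤ 2 ^ q := by
    have : 0 < q := lt_trans (by positivity) hq
    exact Real.one_le_rpow (by norm_num) this.le
  have hh : 0 < b - a := by linarith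
  have b0 : 0 < b := by linarith
  have sub : Set.Icc a b ⊆ Set.Ioc 0 1 := fun w hw => ⟨by linarith [hw.1], by linarith [hw.2]⟩
  have y0 : ∀ y ∈ Set.Icc a b, 0 ≤ y := fun y hy => (sub hy).1.le
  rw [bForm_congr (F := fun z => cornerKernel p x z) (F' := k1) hab.le (fun y _ => rfl)
    (fun y hy => (hk y (y0 y hy)).1.deriv)]
  rw [← iteratedDerivWithin_one]
  have kb : ∀ y ∈ Set.Icc a b, ∀ (v : ℝ) (m : ℕ), |v| * (x + y) ^ m ≤ K * (x / (x + y) ^ 2) →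
      |v| * (b - a) ^ m ≤ K * (x / (x + a) ^ 2) * ((b - a) / a) ^ m := by
    intro y hy v m hv
    have hy1 := hy.1
    have hy0 := (sub hy).1
    calc |v| * (b - a) ^ m = |v| * a ^ m * ((b - a) / a) ^ m := by rw [div_pow]; field_simp
      _ ≤ |v| * (x + y) ^ m * ((b - a) / a) ^ m := by gcongr; linarith
      _ ≤ K * (x / (x + y) ^ 2) * ((b - a) / a) ^ m := by gcongr
      _ ≤ K * (x / (x + a) ^ 2) * ((b - a) / a) ^ m := by gcongr
  have ub : ∀ y ∈ Set.Icc a b, ∀ m : ℕ, 1 ≤ m → m ≤ 4 →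
      |iteratedDerivWithin m u (Set.Ioc 0 1) y| * (b - a) ^ m ≤
        N * b ^ α * ((b - a) / a) ^ m := by
    intro y hy m hm1 hm4
    have hy1 := hy.1
    have hy2 := hy.2
    have hy0 := (sub hy).1
    have hv := u_bound hα0 hα1 hb hm1 hm4 (sub hy)
    set v := iteratedDerivWithin m u (Set.Ioc 0 1) y
    calc |v| * (b - a) ^ m = |v| * a ^ m * ((b - a) / a) ^ m := by rw [div_pow]; field_simp
      _ ≤ |v| * y ^ m * ((b - a) / a) ^ m := by gcongr
      _ ≤ N * y ^ α * ((b - a) / a) ^ m := by gcongr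
      _ ≤ N * b ^ α * ((b - a) / a) ^ m := by gcongr
  have ud : ∀ m : ℕ, m < 4 → ∀ y ∈ Set.Icc a b, HasDerivWithinAt
      (iteratedDerivWithin m u (Set.Ioc 0 1))
      (iteratedDerivWithin (m + 1) u (Set.Ioc 0 1) y) (Set.Icc a b) y :=
    fun m hm y hy => (u_deriv hu hm (sub hy)).mono sub
  have eM : (b - a) / a ≤ 2 ^ q := by
    rw [div_le_iff₀ a0]; linarith
  have L := local_bound hab (f0 := fun z => cornerKernel p x z) (f1 := k1) (f2 := k2) (f3 := k3)
    (g0 := u) (g1 := iteratedDerivWithin 1 u (Set.Ioc 0 1))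
    (g2 := iteratedDerivWithin 2 u (Set.Ioc 0 1)) (g3 := iteratedDerivWithin 3 u (Set.Ioc 0 1))
    (F := K * (x / (x + a) ^ 2)) (G := N * b ^ α) (ε := (b - a) / a) (M := 2 ^ q)
    (by positivity) eM (by positivity) (by positivity)
    (fun y hy => (hk y (y0 y hy)).1.hasDerivWithinAt)
    (fun y hy => (hk y (y0 y hy)).2.1.hasDerivWithinAt)
    (fun y hy => (hk y (y0 y hy)).2.2.1.hasDerivWithinAt)
    (fun y hy => by
      have := kb y hy (k1 y) 1 (by simpa using (hk y (y0 y hy)).2.2.2.2.1)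
      simpa using this)
    (fun y hy => kb y hy (k2 y) 2 (hk y (y0 y hy)).2.2.2.2.2.1)
    (fun y hy => kb y hy (k3 y) 3 (hk y (y0 y hy)).2.2.2.2.2.2)
    (fun y hy => by
      have := ud 0 (by norm_num) y hy
      rwa [iteratedDerivWithin_zero] at this)
    (ud 1 (by norm_num)) (ud 2 (by norm_num))
    (fun y hy => by simpa using ub y hy 1 (by norm_num) (by norm_num))
    (fun y hy => ub y hy 2 (by norm_num) (by norm_num))
    (fun y hy => ub y hy 3 (by norm_num) (by norm_num))
  refine L.trans ?_
  have e1 : (b - a) * (x / (x + a) ^ 2) ≤ 2 ^ q * (x / (x + a) - x / (x + b)) := by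
    have : x / (x + a) - x / (x + b) = x * (b - a) / ((x + a) * (x + b)) := by
      field_simp; ring
    rw [this]
    have h3 : x + b ≤ 2 ^ q * (x + a) := by nlinarith
    calc (b - a) * (x / (x + a) ^ 2) = x * (b - a) / ((x + a) * (x + b)) * (x + b) / (x + a) := by
          field_simp
      _ ≤ x * (b - a) / ((x + a) * (x + b)) * (2 ^ q * (x + a)) / (x + a) := by gcongr
      _ = _ := by field_simp
  have e3 : 0 ≤ 2 ^ q * (x / (x + a) - x / (x + b)) := le_trans (by positivity) e1
  calc _ = (1 + 6 * (1 + 2 ^ q) + 3 * (2 ^ q) ^ 2) * (K * N * ((b - a) * (x / (x + a) ^ 2)) *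
        (b ^ α * ((b - a) / a) ^ 4)) := by ring
    _ ≤ (1 + 6 * (1 + 2 ^ q) + 3 * (2 ^ q) ^ 2) *
        (K * N * (2 ^ q * (x / (x + a) - x / (x + b))) *
        (16 * (2 ^ q) ^ 4 * ((n : ℝ) ^ 4)⁻¹)) := by gcongr
    _ = _ := by ring

lemma node_zero {q : ℝ} (hq : 0 < q) (n : ℕ) : gradedNode n q 0 = 0 := by
  simp [gradedNode, Real.zero_rpow hq.ne']

lemma node_last {q : ℝ} {n : ℕ} (hn : 1 ≤ n) : gradedNode n q n = 1 := by
  have : (n : ℝ) ≠ 0 := by positivity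
  simp [gradedNode, this]

lemma node_mono {q : ℝ} (hq : 0 < q) (n : ℕ) : Monotone (gradedNode n q) := by
  intro i j hij
  unfold gradedNode
  exact Real.rpow_le_rpow (by positivity) (by gcongr) hq.le

lemma proj_eq {q : ℝ} (hq : 0 < q) {n : ℕ} {u : ℝ → ℝ} {i : ℕ} (hi : i < n) {y : ℝ}
    (hy : y ∈ Set.Ioc (gradedNode n q i) (gradedNode n q (i + 1))) :
    gradedProj n q u y = (gradedNode n q (i + 1) - gradedNode n q i)⁻¹ *
      ∫ y in gradedNode n q i..gradedNode n q (i + 1), u y := by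
  unfold gradedProj
  rw [intervalIntegral.integral_of_le (node_mono hq n (Nat.le_succ i)),
    Finset.sum_eq_single (i + 1)]
  · simp only [Nat.add_sub_cancel]
    rw [Set.indicator_of_mem hy]
  · intro j hj hji
    apply Set.indicator_of_notMem
    intro h
    rcases Nat.lt_or_gt_of_ne hji with h' | h'
    · have := node_mono hq n (show j ≤ i by omega)
      linarith [h.2, hy.1]
    · have := node_mono hq n (show i + 1 ≤ j - 1 by omega)
      linarith [h.1, hy.2]
  · intro h; exact absurd (Finset.mem_Icc.2 ⟨by omega, by omega⟩) h

lemma first_bound {p α q : ℝ} (hα0 : 0 < α) (hα1 : α < 1) (hq : q > 4 / α) {K : ℝ} (hK : 0 < K)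
    {x : ℝ} (hx : 0 < x)
    (hk : ∀ y : ℝ, 0 ≤ y → |cornerKernel p x y| ≤ K * (x / (x + y) ^ 2))
    {u : ℝ → ℝ} (hu : ContDiffOn ℝ 4 u (Set.Ioc 0 1)) (hb : BddAbove (weightedSet 4 α u))
    (hui : IntervalIntegrable u volume 0 1)
    {n : ℕ} (hn : 1 ≤ n) :
    |∫ y in (0 : ℝ)..gradedNode n q 1, cornerKernel p x y *
      (u y - (gradedNode n q 1 - 0)⁻¹ * ∫ y in (0 : ℝ)..gradedNode n q 1, u y)| ≤
      K / α * ((n : ℝ) ^ 4)⁻¹ * weightedNorm 4 α u := by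
  have hq0 : 0 < q := lt_trans (by positivity) hq
  have hqα : 4 < q * α := by rwa [gt_iff_lt, div_lt_iff₀ hα0] at hq
  have hn' : (1 : ℝ) ≤ n := by exact_mod_cast hn
  have ht : gradedNode n q 1 = (1 / (n : ℝ)) ^ q := by simp [gradedNode]
  have hT0 : 0 < gradedNode n q 1 := by rw [ht]; positivity
  have hT1 : gradedNode n q 1 ≤ 1 := by
    rw [← node_last (q := q) hn]; exact node_mono hq0 n hn
  have hTα : gradedNode n q 1 ^ α ≤ ((n : ℝ) ^ 4)⁻¹ := by
    rw [ht, ← Real.rpow_mul (by positivity), ← one_div, ← one_div_pow, ← Real.rpow_natCast]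
    exact Real.rpow_le_rpow_of_exponent_ge (by positivity)
        (by rw [div_le_one (by linarith)]; exact hn') (by push_cast; linarith)
  set T := gradedNode n q 1
  set N := weightedNorm 4 α u with hN
  have hN0 : 0 ≤ N := (abs_nonneg _).trans (u_bound0 hα0 hb (t := 1) (by simp))
  have huT : IntervalIntegrable u volume 0 T := hui.mono_set (by
    rw [Set.uIcc_of_le hT0.le, Set.uIcc_of_le zero_le_one]; exact Set.Icc_subset_Icc_right hT1)
  have dev : ∀ y ∈ Set.Ioc 0 T, |u y - (T - 0)⁻¹ * ∫ y in (0 : ℝ)..T, u y| ≤ N / α * T ^ α := by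
    intro y hy
    have e : u y - (T - 0)⁻¹ * ∫ y in (0 : ℝ)..T, u y = T⁻¹ * ∫ z in (0 : ℝ)..T, (u y - u z) := by
      rw [intervalIntegral.integral_sub (by simp) huT]
      simp; field_simp
    have b := intervalIntegral.norm_integral_le_of_norm_le_const (a := 0) (b := T)
      (f := fun z => u y - u z) (C := N / α * T ^ α) (fun z hz => by
        rw [Set.uIoc_of_le hT0.le] at hz
        exact u_holder hα0 hα1 hu hb hz.1 hy.1 hz.2 hy.2 hT1)
    rw [e, abs_mul, abs_of_pos (inv_pos.2 hT0)]
    rw [sub_zero, abs_of_pos hT0, Real.norm_eq_abs] at b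
    calc _ ≤ T⁻¹ * (N / α * T ^ α * T) := by gcongr
      _ = _ := by field_simp
  have hWd : ∀ y ∈ Set.uIcc 0 T, HasDerivAt (fun y => - (K * (N / α * T ^ α)) * (x / (x + y)))
      (K * (x / (x + y) ^ 2) * (N / α * T ^ α)) y := by
    intro y hy
    rw [Set.uIcc_of_le hT0.le] at hy
    have hxy : x + y ≠ 0 := by linarith [hy.1]
    refine HasDerivAt.congr_deriv (((hasDerivAt_const y x).div
      ((hasDerivAt_id y).const_add x) hxy).const_mul _) ?_
    simp; field_simp
  have hci : IntervalIntegrable (fun y => K * (x / (x + y) ^ 2) * (N / α * T ^ α)) volume 0 T := by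
    apply ContinuousOn.intervalIntegrable
    intro y hy
    rw [Set.uIcc_of_le hT0.le] at hy
    have hxy : (x + y) ^ 2 ≠ 0 := by have := hy.1; positivity
    apply ContinuousAt.continuousWithinAt
    fun_prop (disch := assumption)
  have I := intervalIntegral.integral_eq_sub_of_hasDerivAt hWd hci
  have J := intervalIntegral.norm_integral_le_of_norm_le (a := 0) (b := T) (μ := volume)
    (f := fun y => cornerKernel p x y * (u y - (T - 0)⁻¹ * ∫ y in (0 : ℝ)..T, u y))
    (g := fun y => K * (x / (x + y) ^ 2) * (N / α * T ^ α)) hT0.le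
    (Filter.Eventually.of_forall fun y hy => by
      rw [Real.norm_eq_abs, abs_mul]
      exact mul_le_mul (hk y hy.1.le) (dev y hy) (abs_nonneg _) (by positivity)) hci
  rw [I, Real.norm_eq_abs] at J
  refine J.trans ?_
  have w : 0 ≤ x / (x + T) := by positivity
  have w1 : x / (x + 0) = 1 := by field_simp; ring
  rw [w1]
  have c0 : 0 ≤ K * (N / α * T ^ α) := by positivity
  calc _ ≤ K * (N / α * T ^ α) := by nlinarith
    _ ≤ K * (N / α * ((n : ℝ) ^ 4)⁻¹) := by gcongr
    _ = _ := by ring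

/-- Asymptotic expansion of `K(I − π_h)u` on the graded mesh: for `p ∈ (0,1)`,
`0 < α < 1/(1+p)` and `q > 4/α`, there is a constant `C > 0`, independent of `n` and
`u`, such that for every `u ∈ C⁴_α` and every `x ∈ (0,1]`,
`(K(I − π_h)u)(x) = (1/12)·∑_{i=2}^{n} h_i² ∫_{τ_i} ∂_y k(x,y)·u′(y) dy + R_n(x)` with
`sup_{x∈(0,1]} |R_n(x)| ≤ C·n⁻⁴·‖u‖_{4,α}`. -/
theorem cornerErr_asymptotic_expansion (p α q : ℝ)
    (hp0 : 0 < p) (hp1 : p < 1) (hα0 : 0 < α) (hα1 : α < 1 / (1 + p))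
    (hq : q > 4 / α) :
    ∃ C : ℝ, 0 < C ∧ ∀ n : ℕ, 1 ≤ n → ∀ u : ℝ → ℝ,
      ContDiffOn ℝ 4 u (Set.Ioc 0 1) → BddAbove (weightedSet 4 α u) →
      ∀ x ∈ Set.Ioc (0 : ℝ) 1,
        |cornerErr p q n u x -
          (1 / 12) * ∑ i ∈ Finset.Icc 2 n,
            (gradedNode n q i - gradedNode n q (i - 1)) ^ 2 *
              ∫ y in Set.Ioc (gradedNode n q (i - 1)) (gradedNode n q i),
                deriv (fun z => cornerKernel p x z) y *
                  derivWithin u (Set.Ioc 0 1) y| ≤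
          C * ((n : ℝ) ^ 4)⁻¹ * weightedNorm 4 α u := by
  have hα' : α < 1 := hα1.trans_le (by rw [div_le_one (by linarith)]; linarith)
  have hq0 : 0 < q := lt_trans (by positivity) hq
  obtain ⟨K, hK, hKx⟩ := kernel_data p hp0 hp1
  set C1 : ℝ := (1 + 6 * (1 + 2 ^ q) + 3 * (2 ^ q) ^ 2) * (K * 2 ^ q * (16 * (2 ^ q) ^ 4)) with hC1
  have hC10 : 0 < C1 := by positivity
  refine ⟨C1 + K / α, by positivity, ?_⟩
  intro n hn u hu hb x hx
  obtain ⟨k1, k2, k3, hk⟩ := hKx x hx.1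
  set N := weightedNorm 4 α u with hN
  have hN0 : 0 ≤ N := (abs_nonneg _).trans (u_bound0 hα0 hb (t := 1) (by simp))
  obtain ⟨m, rfl⟩ : ∃ m, n = m + 1 := ⟨n - 1, by omega⟩
  set t := gradedNode (m + 1) q with ht
  have t0 : t 0 = 0 := node_zero hq0 _
  have t1 : t (m + 1) = 1 := node_last hn
  have tm : Monotone t := node_mono hq0 _
  have hui : IntervalIntegrable u volume 0 1 := by
    rw [intervalIntegrable_iff_integrableOn_Ioc_of_le zero_le_one]
    have : IsFiniteMeasure (volume.restrict (Set.Ioc (0 : ℝ) 1)) := inferInstance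
    refine Integrable.of_bound (C := N)
      (hu.continuousOn.aestronglyMeasurable measurableSet_Ioc) ?_
    exact (ae_restrict_iff' measurableSet_Ioc).2
      (Filter.Eventually.of_forall fun y hy => u_bound0 hα0 hb hy)
  have kc : ContinuousOn (fun z => cornerKernel p x z) (Set.Icc 0 1) := fun y hy =>
    (hk y hy.1).1.continuousAt.continuousWithinAt
  have tsub : ∀ i, i < m + 1 → Set.uIcc (t i) (t (i + 1)) ⊆ Set.Icc 0 1 := by
    intro i hi
    rw [Set.uIcc_of_le (tm (Nat.le_succ i)), ← t0, ← t1]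
    exact Set.Icc_subset_Icc (tm (Nat.zero_le _)) (tm (by omega))
  have hui' : ∀ i, i < m + 1 → IntervalIntegrable u volume (t i) (t (i + 1)) := fun i hi =>
    hui.mono_set (by rw [Set.uIcc_of_le zero_le_one]; exact tsub i hi)
  set μ : ℕ → ℝ := fun i => (t (i + 1) - t i)⁻¹ * ∫ y in t i..t (i + 1), u y with hμ
  have hcong : ∀ i, i < m + 1 → Set.EqOn (fun y => cornerKernel p x y * (u y - μ i))
      (fun y => cornerKernel p x y * (u y - gradedProj (m + 1) q u y))
      (Set.uIoc (t i) (t (i + 1))) := by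
    intro i hi y hy
    rw [Set.uIoc_of_le (tm (Nat.le_succ i))] at hy
    simp only [proj_eq hq0 hi hy, hμ, ht]
  have hint : ∀ i, i < m + 1 → IntervalIntegrable (fun y => cornerKernel p x y * (u y - μ i))
      volume (t i) (t (i + 1)) := fun i hi =>
    ((hui' i hi).sub intervalIntegrable_const).continuousOn_mul (kc.mono (tsub i hi))
  have split : cornerErr p q (m + 1) u x =
      ∑ i ∈ Finset.range (m + 1), ∫ y in t i..t (i + 1), cornerKernel p x y * (u y - μ i) := by
    unfold cornerErr cornerOp
    rw [← intervalIntegral.integral_of_le zero_le_one]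
    have := intervalIntegral.sum_integral_adjacent_intervals (a := t) (n := m + 1) (μ := volume)
      (f := fun y => cornerKernel p x y * (u y - gradedProj (m + 1) q u y))
      (fun i hi => (hint i hi).congr (hcong i hi))
    rw [t0, t1] at this
    rw [← this]
    refine Finset.sum_congr rfl fun i hi => ?_
    refine intervalIntegral.integral_congr_ae (Filter.Eventually.of_forall fun y hy => ?_)
    exact (hcong i (Finset.mem_range.1 hi) hy).symm
  have hsum : ∀ φ : ℕ → ℝ, ∑ i ∈ Finset.Icc 2 (m + 1), φ i = ∑ i ∈ Finset.range m, φ (i + 2) := by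
    intro φ
    rw [Finset.range_eq_Ico, Finset.sum_Ico_add' φ 0 m 2]
    congr 1
  have hbf : ∀ i ∈ Finset.range m,
      (∫ y in t (i + 1)..t (i + 1 + 1), cornerKernel p x y * (u y - μ (i + 1))) -
      1 / 12 * ((t (i + 2) - t (i + 2 - 1)) ^ 2 *
        ∫ y in Set.Ioc (t (i + 2 - 1)) (t (i + 2)), deriv (fun z => cornerKernel p x z) y *
          derivWithin u (Set.Ioc 0 1) y) =
      bForm (t (i + 1)) (t (i + 1 + 1)) (fun z => cornerKernel p x z)
      (deriv (fun z => cornerKernel p x z)) u (derivWithin u (Set.Ioc 0 1)) := by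
    intro i hi
    have hi' : i + 1 < m + 1 := by have := Finset.mem_range.1 hi; omega
    have e : i + 2 - 1 = i + 1 := by omega
    rw [e, ← intervalIntegral.integral_of_le (tm (Nat.le_succ _))]
    unfold bForm
    have : ∫ y in t (i + 1)..t (i + 1 + 1), cornerKernel p x y * (u y - μ (i + 1)) =
        (∫ y in t (i + 1)..t (i + 1 + 1), cornerKernel p x y * u y) -
        (∫ y in t (i + 1)..t (i + 1 + 1), cornerKernel p x y) * μ (i + 1) := by
      rw [← intervalIntegral.integral_mul_const, ← intervalIntegral.integral_sub]
      · simp only [mul_sub]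
      · exact (hui' _ hi').continuousOn_mul (kc.mono (tsub _ hi'))
      · exact ((kc.mono (tsub _ hi')).intervalIntegrable).mul_const _
    rw [this]
    simp only [hμ]
    ring
  rw [split, hsum, Finset.sum_range_succ', Finset.mul_sum, add_sub_right_comm,
    ← Finset.sum_sub_distrib, Finset.sum_congr rfl hbf]
  have F := first_bound hα0 hα' hq hK hx.1 (fun y hy => (hk y hy).2.2.2.1) hu hb hui hn
  have F' : |∫ y in t 0..t (0 + 1), cornerKernel p x y * (u y - μ 0)| ≤
      K / α * (((m + 1 : ℕ) : ℝ) ^ 4)⁻¹ * N := by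
    simp only [hμ, t0, zero_add]
    exact F
  set Q : ℝ := C1 * (((m + 1 : ℕ) : ℝ) ^ 4)⁻¹ * N with hQ
  have hQ0 : 0 ≤ Q := by positivity
  have S : |∑ i ∈ Finset.range m, bForm (t (i + 1)) (t (i + 1 + 1)) (fun z => cornerKernel p x z)
      (deriv (fun z => cornerKernel p x z)) u (derivWithin u (Set.Ioc 0 1))| ≤ Q := by
    refine (Finset.abs_sum_le_sum_abs _ _).trans ?_
    have : ∀ i ∈ Finset.range m, |bForm (t (i + 1)) (t (i + 1 + 1))
        (fun z => cornerKernel p x z) (deriv (fun z => cornerKernel p x z)) u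
        (derivWithin u (Set.Ioc 0 1))| ≤
        Q * (x / (x + t (i + 1)) - x / (x + t (i + 1 + 1))) := fun i hi =>
      term_bound hα0 hα' hq hK hx.1 hk hu hb (by omega)
        (by have := Finset.mem_range.1 hi; omega)
    refine (Finset.sum_le_sum this).trans ?_
    rw [← Finset.mul_sum, Finset.sum_range_sub' (fun i => x / (x + t (i + 1)))]
    have hx0 := hx.1
    have p1 : 0 ≤ t (0 + 1) := by rw [← t0]; exact tm (Nat.zero_le _)
    have p2 : x / (x + t (0 + 1)) ≤ 1 := by rw [div_le_one (by linarith)]; linarith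
    have p3 : 0 ≤ x / (x + t (m + 1)) := by rw [t1]; positivity
    nlinarith
  refine (abs_add_le _ _).trans ((add_le_add S F').trans (le_of_eq ?_))
  rw [hQ]; ring
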